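/- arXiv:2004.03862 — 3 statements merged into one kernel-verified Lean document; each statement's English description precedes it below -/
import Mathlib

section
/- Fix a real number σ with 0 ≤ σ < 1 and let k, s ∈ [−1,1]. Then the function z ↦ φ(s,k,z) is strictly decreasing on (0,∞): for all real numbers z₁, z₂ with 0 < z₁ < z₂ one has φ(s,k,z₂) < φ(s,k,z₁). (This is the monotonicity statement of Theorem 2.1, expressing that the Fourier components φ_m(y,w) of the Green function, written as φ(s,k,z) with z = mℓ, y = kℓ, w = sℓ, are strictly decreasing in m.) -/
noncomputable section

open Real

/-- `F(z) = ((3+σ)/2)·sinh(2z) − (1−σ)·z`. -/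
def F (σ z : ℝ) : ℝ := ((3 + σ) / 2) * Real.sinh (2 * z) - (1 - σ) * z

/-- `F̄(z) = ((3+σ)/2)·sinh(2z) + (1−σ)·z`. -/
def Fbar (σ z : ℝ) : ℝ := ((3 + σ) / 2) * Real.sinh (2 * z) + (1 - σ) * z

/-- `ψ(k,z)`. -/
def psi (σ k z : ℝ) : ℝ :=
  (2 + (1 - σ) * z) * Real.cosh (k * z) * Real.cosh z
    + (-(1 + σ) + (1 - σ) * z) * Real.cosh (k * z) * Real.sinh z
    - (1 - σ) * k * z * Real.sinh (k * z) * Real.cosh z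
    - (1 - σ) * k * z * Real.sinh (k * z) * Real.sinh z

/-- `ξ(k,z)`. -/
def xi (σ k z : ℝ) : ℝ :=
  -(1 - σ) * k * z * Real.cosh (k * z) * Real.cosh z
    - (1 - σ) * k * z * Real.cosh (k * z) * Real.sinh z
    + (-(1 + σ) + (1 - σ) * z) * Real.sinh (k * z) * Real.cosh z
    + (2 + (1 - σ) * z) * Real.sinh (k * z) * Real.sinh z

/-- `ζ(k,z)`. -/
def zeta (σ k z : ℝ) : ℝ :=
  (4 / (1 - σ) - (1 + σ) * z) * Real.cosh (k * z) * Real.cosh z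
    + ((1 + σ) ^ 2 / (1 - σ) + 2 * z) * Real.cosh (k * z) * Real.sinh z
    - 2 * k * z * Real.sinh (k * z) * Real.cosh z
    + (1 + σ) * k * z * Real.sinh (k * z) * Real.sinh z

/-- `η(k,z)`. -/
def eta (σ k z : ℝ) : ℝ :=
  (1 + σ) * k * z * Real.cosh (k * z) * Real.cosh z
    - 2 * k * z * Real.cosh (k * z) * Real.sinh z
    + ((1 + σ) ^ 2 / (1 - σ) + 2 * z) * Real.sinh (k * z) * Real.cosh z
    + (4 / (1 - σ) - (1 + σ) * z) * Real.sinh (k * z) * Real.sinh z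

/-- `g(s,k,z)`. -/
def g (σ s k z : ℝ) : ℝ :=
  Real.cosh (s * z) *
      (zeta σ k z / F σ z + z * psi σ k z / F σ z - s * z * xi σ k z / Fbar σ z)
    + Real.sinh (s * z) *
      (eta σ k z / Fbar σ z + z * xi σ k z / Fbar σ z - s * z * psi σ k z / F σ z)

/-- `h(s,k,z) = (1+z·|k−s|)·exp(−z·|k−s|)`. -/
def hfun (s k z : ℝ) : ℝ := (1 + z * |k - s|) * Real.exp (-(z * |k - s|))

/-- `φ(s,k,z) = exp(−z)·g(s,k,z) + h(s,k,z)`. -/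
def phi (σ s k z : ℝ) : ℝ := Real.exp (-z) * g σ s k z + hfun s k z

/-- A nonnegative nonincreasing function on the positive half-line. -/
def NonnegAntitone (f : ℝ → ℝ) : Prop :=
  AntitoneOn f (Set.Ioi 0) ∧ ∀ z, 0 < z → 0 ≤ f z

lemma NonnegAntitone.le {f : ℝ → ℝ} (hf : NonnegAntitone f) {x y : ℝ} (hx : 0 < x)
    (hxy : x ≤ y) : f y ≤ f x :=
  hf.1 (Set.mem_Ioi.2 hx) (Set.mem_Ioi.2 (hx.trans_le hxy)) hxy

lemma NonnegAntitone.mul {f g : ℝ → ℝ} (hf : NonnegAntitone f) (hg : NonnegAntitone g) :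
    NonnegAntitone (fun z => f z * g z) :=
  ⟨fun _ hx _ hy hxy => mul_le_mul (hf.1 hx hy hxy) (hg.1 hx hy hxy) (hg.2 _ hy) (hf.2 _ hx),
    fun z hz => mul_nonneg (hf.2 z hz) (hg.2 z hz)⟩

lemma NonnegAntitone.add {f g : ℝ → ℝ} (hf : NonnegAntitone f) (hg : NonnegAntitone g) :
    NonnegAntitone (fun z => f z + g z) :=
  ⟨fun _ hx _ hy hxy => add_le_add (hf.1 hx hy hxy) (hg.1 hx hy hxy),
    fun z hz => add_nonneg (hf.2 z hz) (hg.2 z hz)⟩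

lemma NonnegAntitone.const_mul {f : ℝ → ℝ} (hf : NonnegAntitone f) {c : ℝ} (hc : 0 ≤ c) :
    NonnegAntitone (fun z => c * f z) :=
  ⟨fun _ hx _ hy hxy => mul_le_mul_of_nonneg_left (hf.1 hx hy hxy) hc,
    fun z hz => mul_nonneg hc (hf.2 z hz)⟩

lemma antitoneOn_Ioi_of_hasDerivAt_nonpos {f f' : ℝ → ℝ}
    (hf : ∀ z, 0 < z → HasDerivAt f (f' z) z) (hf' : ∀ z, 0 < z → f' z ≤ 0) :
    AntitoneOn f (Set.Ioi 0) := by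
  refine antitoneOn_of_deriv_nonpos (convex_Ioi 0)
    (fun z hz => (hf z hz).continuousAt.continuousWithinAt)
    (fun z hz => ?_) (fun z hz => ?_)
  · rw [interior_Ioi] at hz
    exact (hf z hz).differentiableAt.differentiableWithinAt
  · rw [interior_Ioi] at hz
    rw [(hf z hz).deriv]
    exact hf' z hz

/-- `exp(2z) / sinh(2z)`, written without cancellation. -/
def expDivSinh (z : ℝ) : ℝ := 2 / (1 - Real.exp (-(4 * z)))

/-- The boundary layer profile `(1/2 + a z) exp(-a z)`. -/
def layer (a z : ℝ) : ℝ := Real.exp (-(a * z)) * (1 / 2 + a * z)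

/-- The ratio `2 ρ z / sinh(2z)`. -/
def sinhRatio (ρ z : ℝ) : ℝ := 2 * ρ * z * Real.exp (-(2 * z)) * expDivSinh z

/-- The denominator factor `1 / (1 - r²)` with `r = 2 ρ z / sinh(2z)`. -/
def coupling (ρ z : ℝ) : ℝ := 1 / (1 - sinhRatio ρ z ^ 2)

lemma one_sub_exp_pos {z : ℝ} (hz : 0 < z) : 0 < 1 - Real.exp (-(4 * z)) := by
  have : Real.exp (-(4 * z)) < 1 := Real.exp_zero ▸ Real.exp_lt_exp.2 (by linarith)
  linarith

lemma expDivSinh_pos {z : ℝ} (hz : 0 < z) : 0 < expDivSinh z :=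
  div_pos two_pos (one_sub_exp_pos hz)

lemma expDivSinh_eq {z : ℝ} (hz : 0 < z) :
    expDivSinh z = Real.exp (2 * z) / Real.sinh (2 * z) := by
  have h := one_sub_exp_pos hz
  have hs : 0 < Real.sinh (2 * z) := Real.sinh_pos_iff.2 (by linarith)
  unfold expDivSinh
  rw [div_eq_div_iff h.ne' hs.ne', Real.sinh_eq]
  have e : Real.exp (2 * z) * Real.exp (-(4 * z)) = Real.exp (-(2 * z)) := by
    rw [← Real.exp_add]; ring_nf
  linear_combination e

lemma sinhRatio_eq {ρ z : ℝ} (hz : 0 < z) :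
    sinhRatio ρ z = 2 * ρ * z / Real.sinh (2 * z) := by
  unfold sinhRatio
  rw [expDivSinh_eq hz, Real.exp_neg]
  field_simp

lemma hasDerivAt_expDivSinh {z : ℝ} (hz : 0 < z) :
    HasDerivAt expDivSinh
      (-(expDivSinh z * (4 * Real.exp (-(4 * z)) / (1 - Real.exp (-(4 * z)))))) z := by
  have h := one_sub_exp_pos hz
  have h1 : HasDerivAt (fun y : ℝ => 1 - Real.exp (-(4 * y)))
      (-(Real.exp (-(4 * z)) * (-(4 * 1)))) z :=
    ((((hasDerivAt_id z).const_mul 4).neg).exp).const_sub 1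
  have h2 := (hasDerivAt_const z (2 : ℝ)).div h1 h.ne'
  refine h2.congr_deriv ?_
  unfold expDivSinh
  field_simp
  ring

lemma expDivSinh_nonnegAntitone : NonnegAntitone expDivSinh := by
  refine ⟨antitoneOn_Ioi_of_hasDerivAt_nonpos (fun z hz => hasDerivAt_expDivSinh hz) ?_,
    fun z hz => (expDivSinh_pos hz).le⟩
  intro z hz
  have := expDivSinh_pos hz
  have := one_sub_exp_pos hz
  rw [neg_nonpos]
  positivity

lemma exp_neg_mul_nonnegAntitone {c : ℝ} (hc : 0 ≤ c) :
    NonnegAntitone (fun z => Real.exp (-(c * z))) := by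
  refine ⟨fun x _ y _ hxy => ?_, fun z _ => (Real.exp_pos _).le⟩
  exact Real.exp_le_exp.2 (neg_le_neg (mul_le_mul_of_nonneg_left hxy hc))

lemma layer_pos {a z : ℝ} (ha : 0 ≤ a) (hz : 0 < z) : 0 < layer a z := by
  unfold layer; positivity

lemma hasDerivAt_layer (a z : ℝ) :
    HasDerivAt (layer a) (Real.exp (-(a * z)) * (a * (1 / 2 - a * z))) z := by
  have h1 : HasDerivAt (fun y : ℝ => Real.exp (-(a * y)))
      (Real.exp (-(a * z)) * (-(a * 1))) z :=
    (((hasDerivAt_id z).const_mul a).neg).exp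
  have h2 : HasDerivAt (fun y : ℝ => 1 / 2 + a * y) (a * 1) z :=
    ((hasDerivAt_id z).const_mul a).const_add _
  refine (h1.mul h2).congr_deriv ?_
  ring

lemma layer_mul_exp_nonnegAntitone {a b : ℝ} (ha : 0 ≤ a) (hab : a ≤ b) :
    NonnegAntitone (fun z => layer a z * Real.exp (-(b * z))) := by
  refine ⟨antitoneOn_Ioi_of_hasDerivAt_nonpos (fun z hz => (hasDerivAt_layer a z).mul
    (((hasDerivAt_id z).const_mul b).neg).exp) ?_,
    fun z hz => mul_nonneg (layer_pos ha hz).le (Real.exp_pos _).le⟩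
  intro z hz
  have hE := mul_pos (Real.exp_pos (-(a * z))) (Real.exp_pos (-(b * z)))
  have key : a * (1 / 2 - a * z) - b * (1 / 2 + a * z) ≤ 0 := by
    have : 0 ≤ a * a * z := by positivity
    have : 0 ≤ b * a * z := by have := ha.trans hab; positivity
    nlinarith
  have := mul_nonpos_of_nonneg_of_nonpos hE.le key
  simp only [layer, id, Pi.neg_apply]
  refine le_of_eq_of_le ?_ this
  ring

lemma one_add_mul_exp_antitoneOn {d : ℝ} :
    AntitoneOn (fun z => (1 + z * d) * Real.exp (-(z * d))) (Set.Ioi 0) := by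
  refine antitoneOn_Ioi_of_hasDerivAt_nonpos
    (fun z _ => ((((hasDerivAt_id z).mul_const d).const_add 1)).mul
    (((hasDerivAt_id z).mul_const d).neg).exp) ?_
  intro z hz
  have : 0 ≤ d ^ 2 * z * Real.exp (-(z * d)) := by positivity
  simp only [id, Pi.neg_apply]
  nlinarith

/-- The bound `exp y ≤ (5 + 6y) / (5 - 2y)`, in polynomial form. -/
lemma five_sub_mul_exp_le {y : ℝ} (hy : 0 ≤ y) :
    (5 - 2 * y) * Real.exp y ≤ 5 + 6 * y := by
  have hd : ∀ x : ℝ, HasDerivAt (fun y : ℝ => 5 + 6 * y - (5 - 2 * y) * Real.exp y)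
      (6 - (3 - 2 * x) * Real.exp x) x := by
    intro x
    have h1 : HasDerivAt (fun y : ℝ => 5 + 6 * y) (6 * 1) x :=
      ((hasDerivAt_id x).const_mul 6).const_add _
    have h2 : HasDerivAt (fun y : ℝ => 5 - 2 * y) (-(2 * 1)) x :=
      ((hasDerivAt_id x).const_mul 2).const_sub _
    refine (h1.sub (h2.mul (Real.hasDerivAt_exp x))).congr_deriv ?_
    ring
  have hm : Monotone (fun y : ℝ => 5 + 6 * y - (5 - 2 * y) * Real.exp y) := by
    refine monotone_of_deriv_nonneg (fun x => (hd x).differentiableAt) (fun x => ?_)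
    rw [(hd x).deriv]
    have h1 : (1 / 2 - x) + 1 ≤ Real.exp (1 / 2 - x) := Real.add_one_le_exp _
    have h2 : Real.exp (1 / 2 - x) * Real.exp x = Real.exp (1 / 2) := by
      rw [← Real.exp_add]; ring_nf
    have h3 : Real.exp (1 / 2) ≤ 3 :=
      (Real.exp_le_exp.2 (by norm_num)).trans Real.exp_one_lt_three.le
    nlinarith [Real.exp_pos x, mul_le_mul_of_nonneg_right h1 (Real.exp_pos x).le]
  have := hm hy
  simp only [mul_zero, add_zero, sub_zero, Real.exp_zero, mul_one] at this
  linarith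

lemma mul_layer_mul_layer_nonnegAntitone {a b : ℝ} (ha : 0 ≤ a) (hb : 0 ≤ b) :
    NonnegAntitone (fun z => z * Real.exp (-(2 * z)) * expDivSinh z * expDivSinh z *
      (layer a z * layer b z)) := by
  refine ⟨antitoneOn_Ioi_of_hasDerivAt_nonpos (fun z hz =>
    ((((hasDerivAt_id z).mul (((hasDerivAt_id z).const_mul 2).neg).exp).mul
    (hasDerivAt_expDivSinh hz)).mul (hasDerivAt_expDivSinh hz)).mul
      ((hasDerivAt_layer a z).mul (hasDerivAt_layer b z))) ?_, fun z hz => ?_⟩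
  · intro z hz
    set K := expDivSinh z with hK
    set l := 4 * Real.exp (-(4 * z)) / (1 - Real.exp (-(4 * z))) with hl
    have hKp : 0 < K := expDivSinh_pos hz
    have hq := one_sub_exp_pos hz
    have hl' : 5 / 4 - 2 * z - 2 * z * l ≤ 0 := by
      have h1 := five_sub_mul_exp_le (y := 4 * z) (by linarith)
      have h2 : Real.exp (4 * z) * Real.exp (-(4 * z)) = 1 := by
        rw [← Real.exp_add]; simp
      have h3 := mul_le_mul_of_nonneg_right h1 (Real.exp_pos (-(4 * z))).le
      rw [mul_assoc, h2] at h3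
      rw [hl]
      have : 5 / 4 - 2 * z - 2 * z * (4 * Real.exp (-(4 * z)) / (1 - Real.exp (-(4 * z))))
          = (5 - 2 * (4 * z) - (5 + 6 * (4 * z)) * Real.exp (-(4 * z))) /
            (4 * (1 - Real.exp (-(4 * z)))) := by
        field_simp
        ring
      rw [this]
      exact div_nonpos_of_nonpos_of_nonneg (by linarith) (by linarith)
    have hu : 0 ≤ a * z := by positivity
    have hv : 0 ≤ b * z := by positivity
    have h1 : ∀ u : ℝ, 0 ≤ u → u * (1 / 2 - u) ≤ (1 / 2 + u) / 8 := fun u hu => by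
      nlinarith [sq_nonneg (u - 1 / 4)]
    have hp : 0 < (1 / 2 + a * z) * (1 / 2 + b * z) := by positivity
    have key : (1 / 2 + a * z) * (1 / 2 + b * z) * (1 - 2 * z - 2 * z * l) +
        (a * z * (1 / 2 - a * z) * (1 / 2 + b * z) + b * z * (1 / 2 - b * z) * (1 / 2 + a * z))
          ≤ 0 := by
      have e1 := mul_le_mul_of_nonneg_right (h1 _ hu) (by linarith : 0 ≤ 1 / 2 + b * z)
      have e2 := mul_le_mul_of_nonneg_right (h1 _ hv) (by linarith : 0 ≤ 1 / 2 + a * z)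
      have e3 := mul_nonpos_of_nonneg_of_nonpos hp.le hl'
      linarith
    have hE : 0 ≤ K * K * Real.exp (-(2 * z)) * Real.exp (-(a * z)) * Real.exp (-(b * z)) := by
      positivity
    have := mul_nonpos_of_nonneg_of_nonpos hE key
    simp only [layer, id, Pi.neg_apply, Pi.mul_apply, ← hK]
    refine le_of_eq_of_le ?_ this
    ring
  · have := expDivSinh_pos hz
    have := layer_pos ha hz
    have := layer_pos hb hz
    positivity

/-- The decay of `exp(-(a+b)z)` outweighs the possible growth of the layer product. -/
lemma exp_add_layer_mul_layer_antitoneOn {a b θ : ℝ} (ha : 0 ≤ a) (hb : 0 ≤ b)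
    (hθ : 0 ≤ θ) (hθ' : θ ≤ 1 / 4) :
    AntitoneOn (fun z => Real.exp (-((a + b) * z)) +
      θ * (expDivSinh z * (layer a z * layer b z))) (Set.Ioi 0) := by
  refine antitoneOn_Ioi_of_hasDerivAt_nonpos (fun z hz =>
    ((((hasDerivAt_id z).const_mul (a + b)).neg).exp).add
    (((hasDerivAt_expDivSinh hz).mul
      ((hasDerivAt_layer a z).mul (hasDerivAt_layer b z))).const_mul θ)) ?_
  intro z hz
  set K := expDivSinh z with hK
  set l := 4 * Real.exp (-(4 * z)) / (1 - Real.exp (-(4 * z))) with hl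
  have hKp : 0 < K := expDivSinh_pos hz
  have hq := one_sub_exp_pos hz
  have hlp : 0 < l := by positivity
  have hA : 0 ≤ a + b := by linarith
  have hKl : K * (1 / 4 - l * z / 2) ≤ 4 := by
    rcases le_total (4 * z) 1 with h | h
    · have h1 : Real.exp (4 * z) ≤ 1 + 2 * (4 * z) := by
        have := (abs_le.1 (Real.abs_exp_sub_one_sub_id_le (x := 4 * z)
          (by rw [abs_of_pos] <;> linarith))).2
        nlinarith
      have h2 : Real.exp (4 * z) * Real.exp (-(4 * z)) = 1 := by
        rw [← Real.exp_add]; simp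
      have h3 := mul_le_mul_of_nonneg_right h1 (Real.exp_pos (-(4 * z))).le
      have h4 : 1 / 4 ≤ l * z / 2 := by
        rw [hl, div_mul_eq_mul_div, div_div, le_div_iff₀ (by positivity)]
        linarith
      nlinarith
    · have h1 : Real.exp (-(4 * z)) ≤ 1 / 2 := by
        have h0 := Real.add_one_le_exp (4 * z)
        rw [Real.exp_neg, inv_le_comm₀ (Real.exp_pos _) (by norm_num)]
        norm_num
        linarith
      have h2 : K ≤ 4 := by
        rw [hK, expDivSinh, div_le_iff₀ hq]
        linarith
      have : 0 < K * (l * z / 2) := by positivity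
      nlinarith
  have hp : (a + b) * z / 2 ≤ (1 / 2 + a * z) * (1 / 2 + b * z) := by
    have : 0 ≤ a * b * z ^ 2 := by positivity
    nlinarith
  have hp' : a * (1 / 2 - a * z) * (1 / 2 + b * z) + b * (1 / 2 - b * z) * (1 / 2 + a * z)
      ≤ (a + b) / 4 := by
    have h1 : 0 ≤ a * b * (a + b) * z ^ 2 := by positivity
    have h2 : 0 ≤ (a - b) ^ 2 * z := by positivity
    nlinarith
  have key : -(a + b) + θ * (K * ((a * (1 / 2 - a * z) * (1 / 2 + b * z) +
      b * (1 / 2 - b * z) * (1 / 2 + a * z)) - l * ((1 / 2 + a * z) * (1 / 2 + b * z)))) ≤ 0 := by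
    have h1 := mul_le_mul_of_nonneg_left hp hlp.le
    have h2 : K * ((a * (1 / 2 - a * z) * (1 / 2 + b * z) +
      b * (1 / 2 - b * z) * (1 / 2 + a * z)) - l * ((1 / 2 + a * z) * (1 / 2 + b * z)))
        ≤ K * ((a + b) / 4 - l * ((a + b) * z / 2)) :=
      mul_le_mul_of_nonneg_left (by linarith) hKp.le
    have h3 : K * ((a + b) / 4 - l * ((a + b) * z / 2)) ≤ (a + b) * 4 := by
      have := mul_le_mul_of_nonneg_left hKl hA
      linarith
    have h4 := mul_le_mul_of_nonneg_left (h2.trans h3) hθ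
    have h5 := mul_le_mul_of_nonneg_right hθ' (by linarith : 0 ≤ (a + b) * 4)
    linarith
  have := mul_nonpos_of_nonneg_of_nonpos (Real.exp_pos (-((a + b) * z))).le key
  have hE : Real.exp (-((a + b) * z)) = Real.exp (-(a * z)) * Real.exp (-(b * z)) := by
    rw [← Real.exp_add]; ring_nf
  simp only [layer, id, Pi.neg_apply, Pi.mul_apply]
  refine le_of_eq_of_le ?_ this
  rw [hE]
  ring

lemma sinh_le_mul_cosh {x : ℝ} (hx : 0 ≤ x) : Real.sinh x ≤ x * Real.cosh x := by
  have hd : ∀ y : ℝ, HasDerivAt (fun y : ℝ => y * Real.cosh y - Real.sinh y)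
      (y * Real.sinh y) y := fun y =>
    (((hasDerivAt_id y).mul (Real.hasDerivAt_cosh y)).sub (Real.hasDerivAt_sinh y)).congr_deriv
      (by simp)
  have hm : Monotone (fun y : ℝ => y * Real.cosh y - Real.sinh y) := by
    refine monotone_of_deriv_nonneg (fun y => (hd y).differentiableAt) (fun y => ?_)
    rw [(hd y).deriv]
    rcases le_total 0 y with h | h
    · exact mul_nonneg h (Real.sinh_nonneg_iff.2 h)
    · exact mul_nonneg_of_nonpos_of_nonpos h (Real.sinh_nonpos_iff.2 h)
  have := hm hx
  simp only [zero_mul, Real.sinh_zero, sub_zero] at this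
  linarith

lemma sinhRatio_nonnegAntitone {ρ : ℝ} (hρ : 0 ≤ ρ) : NonnegAntitone (sinhRatio ρ) := by
  have hd : ∀ z : ℝ, 0 < z → HasDerivAt (fun z => z / Real.sinh (2 * z))
      ((1 * Real.sinh (2 * z) - z * (Real.cosh (2 * z) * (2 * 1))) / Real.sinh (2 * z) ^ 2) z :=
    fun z hz => (hasDerivAt_id z).div (((hasDerivAt_id z).const_mul 2).sinh)
      (Real.sinh_pos_iff.2 (by simpa using hz)).ne'
  have h : AntitoneOn (fun z => z / Real.sinh (2 * z)) (Set.Ioi 0) := by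
    refine antitoneOn_Ioi_of_hasDerivAt_nonpos hd (fun z hz => ?_)
    refine div_nonpos_of_nonpos_of_nonneg ?_ (sq_nonneg _)
    have := sinh_le_mul_cosh (x := 2 * z) (by linarith)
    linarith
  refine ⟨fun x hx y hy hxy => ?_, fun z hz => ?_⟩
  · rw [sinhRatio_eq hx, sinhRatio_eq hy, mul_div_assoc, mul_div_assoc]
    exact mul_le_mul_of_nonneg_left (h hx hy hxy) (by linarith)
  · have := expDivSinh_pos hz
    unfold sinhRatio
    positivity

lemma sinhRatio_le {ρ z : ℝ} (hρ : 0 ≤ ρ) (hz : 0 < z) : sinhRatio ρ z ≤ ρ := by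
  have h : 2 * z ≤ Real.sinh (2 * z) := Real.self_le_sinh_iff.2 (by linarith)
  rw [sinhRatio_eq hz, div_le_iff₀ (by linarith)]
  nlinarith

lemma sinhRatio_sq_le {ρ z : ℝ} (hρ : 0 ≤ ρ) (hρ' : ρ ≤ 1 / 3) (hz : 0 < z) :
    sinhRatio ρ z ^ 2 ≤ 1 / 9 := by
  have h1 := (sinhRatio_nonnegAntitone hρ).2 z hz
  have h2 := sinhRatio_le hρ hz
  nlinarith

lemma coupling_nonnegAntitone {ρ : ℝ} (hρ : 0 ≤ ρ) (hρ' : ρ ≤ 1 / 3) :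
    NonnegAntitone (coupling ρ) := by
  have hr := sinhRatio_nonnegAntitone hρ
  refine ⟨fun x hx y hy hxy => ?_, fun z hz => ?_⟩
  · have h1 := sinhRatio_sq_le hρ hρ' (Set.mem_Ioi.1 hx)
    have h2 := pow_le_pow_left₀ (hr.2 y hy) (hr.1 hx hy hxy) 2
    exact one_div_le_one_div_of_le (by linarith) (by linarith)
  · have h1 := sinhRatio_sq_le hρ hρ' hz
    exact div_nonneg zero_le_one (by linarith)

lemma coupling_le {ρ z : ℝ} (hρ : 0 ≤ ρ) (hρ' : ρ ≤ 1 / 3) (hz : 0 < z) :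
    coupling ρ z ≤ 9 / 8 := by
  have h1 := sinhRatio_sq_le hρ hρ' hz
  rw [coupling, div_le_iff₀ (by linarith)]
  linarith

lemma coupling_pos {ρ z : ℝ} (hρ : 0 ≤ ρ) (hρ' : ρ ≤ 1 / 3) (hz : 0 < z) :
    0 < coupling ρ z := by
  have h1 := sinhRatio_sq_le hρ hρ' hz
  exact div_pos one_pos (by linarith)

/-- A boundary layer together with its reflection in the opposite endpoint. -/
def reflectedLayer (ρ a z : ℝ) : ℝ := layer a z + Real.exp (-((4 - a) * z)) / (2 * ρ)

lemma NonnegAntitone.congr {f g : ℝ → ℝ} (hf : NonnegAntitone f) (h : ∀ z, f z = g z) :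
    NonnegAntitone g := by
  rwa [← funext h]

/-- The part of a product of two reflected layers that is not the product of the layers. -/
lemma reflection_product_nonnegAntitone {ρ a b : ℝ} (hρ : 0 < ρ)
    (ha : 0 ≤ a) (ha2 : a ≤ 2) (hb : 0 ≤ b) (hb2 : b ≤ 2) :
    NonnegAntitone (fun z => (1 / (2 * ρ)) * (layer a z * Real.exp (-((4 - b) * z)) +
      layer b z * Real.exp (-((4 - a) * z)))) :=
  ((layer_mul_exp_nonnegAntitone ha (by linarith)).add
    (layer_mul_exp_nonnegAntitone hb (by linarith))).const_mul (by positivity)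

lemma reflectedLayer_mul (ρ a b z : ℝ) :
    reflectedLayer ρ a z * reflectedLayer ρ b z = layer a z * layer b z +
      ((1 / (2 * ρ)) * (layer a z * Real.exp (-((4 - b) * z)) +
        layer b z * Real.exp (-((4 - a) * z))) +
      (1 / (2 * ρ)) ^ 2 * Real.exp (-((8 - a - b) * z))) := by
  have : Real.exp (-((8 - a - b) * z)) =
      Real.exp (-((4 - a) * z)) * Real.exp (-((4 - b) * z)) := by
    rw [← Real.exp_add]; ring_nf
  rw [this, reflectedLayer, reflectedLayer]
  ring

/-- Interaction of the layers at opposite endpoints. -/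
lemma opposite_interaction_nonnegAntitone {ρ a b : ℝ} (hρ : 0 < ρ) (hρ' : ρ ≤ 1 / 3)
    (ha : 0 ≤ a) (ha2 : a ≤ 2) (hb : 0 ≤ b) (hb2 : b ≤ 2) :
    NonnegAntitone (fun z => ρ * (coupling ρ z * (expDivSinh z * sinhRatio ρ z *
      (reflectedLayer ρ a z * reflectedLayer ρ b z)))) := by
  refine ((coupling_nonnegAntitone hρ.le hρ').mul (NonnegAntitone.congr
    (((mul_layer_mul_layer_nonnegAntitone ha hb).const_mul (by positivity : 0 ≤ 2 * ρ)).add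
      ((expDivSinh_nonnegAntitone.mul (sinhRatio_nonnegAntitone hρ.le)).mul
        ((reflection_product_nonnegAntitone hρ ha ha2 hb hb2).add
          ((exp_neg_mul_nonnegAntitone (by linarith : 0 ≤ 8 - a - b)).const_mul
            (sq_nonneg (1 / (2 * ρ))))))) (fun z => ?_))).const_mul hρ.le
  rw [reflectedLayer_mul, sinhRatio]
  ring

/-- Interaction of the layers at a common endpoint, with the elementary exponential term. -/
lemma common_interaction_strictAntiOn {ρ a b : ℝ} (hρ : 0 < ρ) (hρ' : ρ ≤ 1 / 3)
    (ha : 0 ≤ a) (ha2 : a ≤ 2) (hb : 0 ≤ b) (hb2 : b ≤ 2) :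
    StrictAntiOn (fun z => (1 / (2 * ρ)) * Real.exp (-((a + b) * z)) +
      ρ * (coupling ρ z * (expDivSinh z *
        (reflectedLayer ρ a z * reflectedLayer ρ b z)))) (Set.Ioi 0) := by
  intro x hx y hy hxy
  have hx0 : 0 < x := hx
  have hy0 : 0 < y := hy
  have hW := coupling_nonnegAntitone hρ.le hρ'
  have hWx := coupling_pos hρ.le hρ' hx0
  have hWxy : coupling ρ y ≤ coupling ρ x := hW.le hx0 hxy.le
  have hθ : 2 * ρ ^ 2 * coupling ρ x ≤ 1 / 4 := by
    have h1 : ρ ^ 2 ≤ 1 / 9 := by nlinarith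
    have h2 := coupling_le hρ.le hρ' hx0
    nlinarith
  have h1 := exp_add_layer_mul_layer_antitoneOn ha hb (by positivity) hθ hx hy hxy.le
  have h1' := mul_le_mul_of_nonneg_left h1 (by positivity : 0 ≤ 1 / (2 * ρ))
  have e : ∀ t l : ℝ, (1 / (2 * ρ)) * (t + 2 * ρ ^ 2 * coupling ρ x * l) =
      (1 / (2 * ρ)) * t + ρ * (coupling ρ x * l) := fun t l => by
    field_simp
  simp only [e] at h1'
  have hKl : 0 ≤ expDivSinh y * (layer a y * layer b y) :=
    mul_nonneg (expDivSinh_pos hy0).le (mul_nonneg (layer_pos ha hy0).le (layer_pos hb hy0).le)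
  have h2 := mul_le_mul_of_nonneg_left (mul_le_mul_of_nonneg_right hWxy hKl) hρ.le
  have h3 := ((hW.mul (expDivSinh_nonnegAntitone.mul
    (reflection_product_nonnegAntitone hρ ha ha2 hb hb2))).const_mul hρ.le).le hx0 hxy.le
  have h4 : Real.exp (-((8 - a - b) * y)) < Real.exp (-((8 - a - b) * x)) :=
    Real.exp_lt_exp.2 (neg_lt_neg (mul_lt_mul_of_pos_left hxy (by linarith)))
  have h5 := (hW.mul expDivSinh_nonnegAntitone).le hx0 hxy.le
  have hWK : 0 < coupling ρ x * expDivSinh x := mul_pos hWx (expDivSinh_pos hx0)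
  have h6 : coupling ρ y * expDivSinh y * Real.exp (-((8 - a - b) * y)) <
      coupling ρ x * expDivSinh x * Real.exp (-((8 - a - b) * x)) :=
    (mul_le_mul_of_nonneg_right h5 (Real.exp_pos _).le).trans_lt
      (mul_lt_mul_of_pos_left h4 hWK)
  have h7 := mul_lt_mul_of_pos_left h6 (by positivity : 0 < ρ * (1 / (2 * ρ)) ^ 2)
  simp only [reflectedLayer_mul]
  linarith

/-- Closed form of the even part of the regular Green function component. -/
lemma even_part_eq {σ ρ : ℝ} (hρ : 0 < ρ) (hσ : σ = (1 - 3 * ρ) / (1 + ρ)) (s k z : ℝ) :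
    Real.exp (-z) * (Real.cosh (s * z) * (zeta σ k z + z * psi σ k z) -
      Real.sinh (s * z) * (s * z * psi σ k z)) =
    2 / (1 + ρ) * (Real.exp (-z) ^ 2 / ρ * Real.cosh (k * z) * Real.cosh (s * z) *
      (Real.sinh (2 * z) - 2 * ρ * z) + 2 * ρ *
      (((z + 1 / 2 + Real.exp (-z) ^ 2 / (2 * ρ)) * Real.cosh (k * z)
        - k * z * Real.sinh (k * z)) *
      ((z + 1 / 2 + Real.exp (-z) ^ 2 / (2 * ρ)) * Real.cosh (s * z)
        - s * z * Real.sinh (s * z)))) := by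
  have hE := Real.exp_pos z
  have h1 : (1 + ρ) ≠ 0 := by positivity
  have h2 : 1 - σ = 4 * ρ / (1 + ρ) := by rw [hσ]; field_simp; ring
  have h3 : 1 + σ = 2 * (1 - ρ) / (1 + ρ) := by rw [hσ]; field_simp; ring
  rw [Real.sinh_two_mul]
  unfold zeta psi
  rw [h2, h3, Real.cosh_eq z, Real.sinh_eq z, Real.exp_neg]
  field_simp
  ring

/-- Closed form of the odd part of the regular Green function component. -/
lemma odd_part_eq {σ ρ : ℝ} (hρ : 0 < ρ) (hσ : σ = (1 - 3 * ρ) / (1 + ρ)) (s k z : ℝ) :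
    Real.exp (-z) * (Real.sinh (s * z) * (eta σ k z + z * xi σ k z) -
      Real.cosh (s * z) * (s * z * xi σ k z)) =
    2 / (1 + ρ) * (Real.exp (-z) ^ 2 / ρ * Real.sinh (k * z) * Real.sinh (s * z) *
      (Real.sinh (2 * z) + 2 * ρ * z) + 2 * ρ *
      (((z + 1 / 2 - Real.exp (-z) ^ 2 / (2 * ρ)) * Real.sinh (k * z)
        - k * z * Real.cosh (k * z)) *
      ((z + 1 / 2 - Real.exp (-z) ^ 2 / (2 * ρ)) * Real.sinh (s * z)
        - s * z * Real.cosh (s * z)))) := by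
  have hE := Real.exp_pos z
  have h1 : (1 + ρ) ≠ 0 := by positivity
  have h2 : 1 - σ = 4 * ρ / (1 + ρ) := by rw [hσ]; field_simp; ring
  have h3 : 1 + σ = 2 * (1 - ρ) / (1 + ρ) := by rw [hσ]; field_simp; ring
  rw [Real.sinh_two_mul]
  unfold eta xi
  rw [h2, h3, Real.cosh_eq z, Real.sinh_eq z, Real.exp_neg]
  field_simp
  ring

lemma cosh_mode_eq (ρ k z : ℝ) :
    (z + 1 / 2 + Real.exp (-z) ^ 2 / (2 * ρ)) * Real.cosh (k * z) - k * z * Real.sinh (k * z) =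
      Real.exp z / 2 * (reflectedLayer ρ (1 - k) z + reflectedLayer ρ (1 + k) z) := by
  have e1 : Real.exp (-((1 - k) * z)) = Real.exp (-z) * Real.exp (k * z) := by
    rw [← Real.exp_add]; ring_nf
  have e2 : Real.exp (-((1 + k) * z)) = Real.exp (-z) * Real.exp (-(k * z)) := by
    rw [← Real.exp_add]; ring_nf
  have e3 : Real.exp (-((4 - (1 - k)) * z)) = Real.exp (-z) ^ 3 * Real.exp (-(k * z)) := by
    rw [← Real.exp_nat_mul, ← Real.exp_add]; push_cast; ring_nf
  have e4 : Real.exp (-((4 - (1 + k)) * z)) = Real.exp (-z) ^ 3 * Real.exp (k * z) := by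
    rw [← Real.exp_nat_mul, ← Real.exp_add]; push_cast; ring_nf
  have hE := Real.exp_pos z
  rw [reflectedLayer, reflectedLayer, layer, layer, e1, e2, e3, e4, Real.cosh_eq, Real.sinh_eq,
    Real.exp_neg z]
  field_simp
  ring

lemma sinh_mode_eq (ρ k z : ℝ) :
    (z + 1 / 2 - Real.exp (-z) ^ 2 / (2 * ρ)) * Real.sinh (k * z) - k * z * Real.cosh (k * z) =
      Real.exp z / 2 * (reflectedLayer ρ (1 - k) z - reflectedLayer ρ (1 + k) z) := by
  have e1 : Real.exp (-((1 - k) * z)) = Real.exp (-z) * Real.exp (k * z) := by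
    rw [← Real.exp_add]; ring_nf
  have e2 : Real.exp (-((1 + k) * z)) = Real.exp (-z) * Real.exp (-(k * z)) := by
    rw [← Real.exp_add]; ring_nf
  have e3 : Real.exp (-((4 - (1 - k)) * z)) = Real.exp (-z) ^ 3 * Real.exp (-(k * z)) := by
    rw [← Real.exp_nat_mul, ← Real.exp_add]; push_cast; ring_nf
  have e4 : Real.exp (-((4 - (1 + k)) * z)) = Real.exp (-z) ^ 3 * Real.exp (k * z) := by
    rw [← Real.exp_nat_mul, ← Real.exp_add]; push_cast; ring_nf
  have hE := Real.exp_pos z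
  rw [reflectedLayer, reflectedLayer, layer, layer, e1, e2, e3, e4, Real.cosh_eq, Real.sinh_eq,
    Real.exp_neg z]
  field_simp
  ring

/-- Representation of `φ` through nonnegative boundary layer interactions. -/
lemma phi_eq_interactions {σ ρ : ℝ} (hρ : 0 < ρ) (hρ' : ρ ≤ 1 / 3)
    (hσ : σ = (1 - 3 * ρ) / (1 + ρ)) (s k : ℝ) {z : ℝ} (hz : 0 < z) :
    phi σ s k z =
      ((1 / (2 * ρ)) * Real.exp (-(((1 - k) + (1 - s)) * z)) +
        ρ * (coupling ρ z * (expDivSinh z *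
          (reflectedLayer ρ (1 - k) z * reflectedLayer ρ (1 - s) z)))) +
      ((1 / (2 * ρ)) * Real.exp (-(((1 + k) + (1 + s)) * z)) +
        ρ * (coupling ρ z * (expDivSinh z *
          (reflectedLayer ρ (1 + k) z * reflectedLayer ρ (1 + s) z)))) +
      ρ * (coupling ρ z * (expDivSinh z * sinhRatio ρ z *
          (reflectedLayer ρ (1 - k) z * reflectedLayer ρ (1 + s) z))) +
      ρ * (coupling ρ z * (expDivSinh z * sinhRatio ρ z *
          (reflectedLayer ρ (1 + k) z * reflectedLayer ρ (1 - s) z))) +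
      hfun s k z := by
  have hN : 2 * z ≤ Real.sinh (2 * z) := Real.self_le_sinh_iff.2 (by linarith)
  have h1 : 1 + ρ ≠ 0 := by positivity
  have h2 : 1 - σ = 4 * ρ / (1 + ρ) := by rw [hσ]; field_simp; ring
  have h3 : 3 + σ = 4 / (1 + ρ) := by rw [hσ]; field_simp; ring
  have hD : 0 < Real.sinh (2 * z) - 2 * ρ * z := by nlinarith
  have hD' : 0 < Real.sinh (2 * z) + 2 * ρ * z := by
    have : 0 < ρ * z := by positivity
    linarith
  have hF : F σ z = 2 / (1 + ρ) * (Real.sinh (2 * z) - 2 * ρ * z) := by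
    rw [F, h2, h3]; field_simp; ring
  have hF' : Fbar σ z = 2 / (1 + ρ) * (Real.sinh (2 * z) + 2 * ρ * z) := by
    rw [Fbar, h2, h3]; field_simp; ring
  have hc : 0 < 2 / (1 + ρ) := by positivity
  have hsplit : Real.exp (-z) * g σ s k z =
      Real.exp (-z) * (Real.cosh (s * z) * (zeta σ k z + z * psi σ k z) -
        Real.sinh (s * z) * (s * z * psi σ k z)) / F σ z +
      Real.exp (-z) * (Real.sinh (s * z) * (eta σ k z + z * xi σ k z) -
        Real.cosh (s * z) * (s * z * xi σ k z)) / Fbar σ z := by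
    rw [g]; ring
  have hev : 1 / (2 * ρ) * Real.exp (-(((1 - k) + (1 - s)) * z)) +
      1 / (2 * ρ) * Real.exp (-(((1 + k) + (1 + s)) * z)) =
      Real.exp (-z) ^ 2 / ρ * Real.cosh (k * z) * Real.cosh (s * z) +
      Real.exp (-z) ^ 2 / ρ * Real.sinh (k * z) * Real.sinh (s * z) := by
    have e1 : Real.exp (-(((1 - k) + (1 - s)) * z)) =
        Real.exp (-z) ^ 2 * Real.exp (k * z) * Real.exp (s * z) := by
      rw [← Real.exp_nat_mul, ← Real.exp_add, ← Real.exp_add]; push_cast; ring_nf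
    have e2 : Real.exp (-(((1 + k) + (1 + s)) * z)) =
        Real.exp (-z) ^ 2 * Real.exp (-(k * z)) * Real.exp (-(s * z)) := by
      rw [← Real.exp_nat_mul, ← Real.exp_add, ← Real.exp_add]; push_cast; ring_nf
    rw [e1, e2, Real.cosh_eq, Real.cosh_eq, Real.sinh_eq, Real.sinh_eq]
    ring
  have hW : coupling ρ z = Real.sinh (2 * z) ^ 2 /
      ((Real.sinh (2 * z) - 2 * ρ * z) * (Real.sinh (2 * z) + 2 * ρ * z)) := by
    have hN0 : Real.sinh (2 * z) ≠ 0 := by linarith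
    have : 1 - (2 * ρ * z / Real.sinh (2 * z)) ^ 2 =
        ((Real.sinh (2 * z) - 2 * ρ * z) * (Real.sinh (2 * z) + 2 * ρ * z)) /
          Real.sinh (2 * z) ^ 2 := by
      field_simp
      ring
    rw [coupling, sinhRatio_eq hz, this, one_div_div]
  have hlayers : ∀ x x' y y' : ℝ,
      2 * ρ * (Real.exp z / 2 * (x + x') * (Real.exp z / 2 * (y + y'))) /
        (Real.sinh (2 * z) - 2 * ρ * z) +
      2 * ρ * (Real.exp z / 2 * (x - x') * (Real.exp z / 2 * (y - y'))) /
        (Real.sinh (2 * z) + 2 * ρ * z) =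
      ρ * (coupling ρ z * (expDivSinh z * (x * y))) +
      ρ * (coupling ρ z * (expDivSinh z * (x' * y'))) +
      ρ * (coupling ρ z * (expDivSinh z * sinhRatio ρ z * (x * y'))) +
      ρ * (coupling ρ z * (expDivSinh z * sinhRatio ρ z * (x' * y))) := by
    intro x x' y y'
    have hN0 : Real.sinh (2 * z) ≠ 0 := by linarith
    have hexp : Real.exp (2 * z) = Real.exp z ^ 2 := by
      rw [← Real.exp_nat_mul]; push_cast; rfl
    rw [hW, sinhRatio_eq hz, expDivSinh_eq hz, hexp]
    generalize Real.sinh (2 * z) = N at *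
    have := hD.ne'
    have := hD'.ne'
    field_simp
    ring
  have hquot : ∀ A B D : ℝ, 0 < D →
      2 / (1 + ρ) * (A * D + B) / (2 / (1 + ρ) * D) = A + B / D := by
    intro A B D hD
    field_simp
  rw [phi, hsplit, even_part_eq hρ hσ, odd_part_eq hρ hσ, hF, hF', hquot _ _ _ hD,
    hquot _ _ _ hD', cosh_mode_eq, cosh_mode_eq, sinh_mode_eq, sinh_mode_eq]
  have := hlayers (reflectedLayer ρ (1 - k) z) (reflectedLayer ρ (1 + k) z)
    (reflectedLayer ρ (1 - s) z) (reflectedLayer ρ (1 + s) z)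
  linarith

/-- Monotonicity part of Theorem 2.1: for fixed σ ∈ [0,1) and k, s ∈ [−1,1], the
function z ↦ φ(s,k,z) is strictly decreasing on (0,∞). -/
theorem phi_strict_decreasing (σ : ℝ) (hσ0 : 0 ≤ σ) (hσ1 : σ < 1)
    (k s : ℝ) (hk : k ∈ Set.Icc (-1 : ℝ) 1) (hs : s ∈ Set.Icc (-1 : ℝ) 1) :
    ∀ z₁ z₂ : ℝ, 0 < z₁ → z₁ < z₂ → phi σ s k z₂ < phi σ s k z₁ := by
  intro x y hx hxy
  obtain ⟨hk1, hk2⟩ := hk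
  obtain ⟨hs1, hs2⟩ := hs
  have hy := hx.trans hxy
  obtain ⟨ρ, hρdef⟩ : ∃ ρ, ρ = (1 - σ) / (3 + σ) := ⟨_, rfl⟩
  have hρ : 0 < ρ := hρdef ▸ div_pos (by linarith) (by linarith)
  have hρ' : ρ ≤ 1 / 3 := by
    rw [hρdef, div_le_div_iff₀ (by linarith) (by norm_num)]
    linarith
  have hσ : σ = (1 - 3 * ρ) / (1 + ρ) := by
    rw [eq_div_iff (by positivity), hρdef]
    field_simp
    ring
  have h1 := common_interaction_strictAntiOn hρ hρ' (a := 1 - k) (b := 1 - s) (by linarith)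
    (by linarith) (by linarith) (by linarith) (Set.mem_Ioi.2 hx) (Set.mem_Ioi.2 hy) hxy
  have h2 := common_interaction_strictAntiOn hρ hρ' (a := 1 + k) (b := 1 + s) (by linarith)
    (by linarith) (by linarith) (by linarith) (Set.mem_Ioi.2 hx) (Set.mem_Ioi.2 hy) hxy
  have h3 := (opposite_interaction_nonnegAntitone hρ hρ' (a := 1 - k) (b := 1 + s) (by linarith)
    (by linarith) (by linarith) (by linarith)).le hx hxy.le
  have h4 := (opposite_interaction_nonnegAntitone hρ hρ' (a := 1 + k) (b := 1 - s) (by linarith)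
    (by linarith) (by linarith) (by linarith)).le hx hxy.le
  have h5 : hfun s k y ≤ hfun s k x :=
    one_add_mul_exp_antitoneOn (Set.mem_Ioi.2 hx) (Set.mem_Ioi.2 hy) hxy.le
  rw [phi_eq_interactions hρ hρ' hσ s k hx, phi_eq_interactions hρ hρ' hσ s k hy]
  exact add_lt_add_of_lt_of_le
    (add_lt_add_of_lt_of_le (add_lt_add_of_lt_of_le (add_lt_add h1 h2) h3) h4) h5
end
end

section
/- Fix a real number σ with 0 ≤ σ < 1. Then φ(s,k,z) > 0 for all z > 0 and all k, s ∈ [−1,1]. (This is the positivity statement of Theorem 2.1 for the Fourier components φ_m(y,w) of the Green function, written as φ(s,k,z) with z = mℓ, y = kℓ, w = sℓ.) -/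
noncomputable section

open Real

/-- First fundamental solution of the plate equation satisfying the free-edge conditions at `0`. -/
def edgeSolOne (σ t : ℝ) : ℝ := cosh t - (1 - σ) / 2 * t * sinh t

/-- Second fundamental solution of the plate equation satisfying the free-edge conditions at `0`. -/
def edgeSolTwo (σ t : ℝ) : ℝ := (1 + σ) * sinh t + (1 - σ) * t * cosh t

/-- Minus the Wronskian of the two fundamental solutions. -/
def edgeWronskian (σ t : ℝ) : ℝ :=
  2 * cosh t ^ 2 - (1 + σ) ^ 2 / 2 * sinh t ^ 2 + (1 - σ) ^ 2 / 2 * t ^ 2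

/-- The derivative of `edgeWronskian` in `t`. -/
def edgeWronskianDeriv (σ t : ℝ) : ℝ :=
  (1 - σ) * (3 + σ) * sinh t * cosh t + (1 - σ) ^ 2 * t

/-- The Green function of the free plate of width `L`, up to a positive factor, for a load at
distance `u` from one edge and an observation point at distance `t` from the other. -/
def greenNum (σ L t u : ℝ) : ℝ :=
  2 * ((3 + σ) * sinh L + (1 - σ) * L * cosh L) * (edgeSolOne σ t * edgeSolOne σ u)
    + (1 - σ) * L * sinh L
      * (edgeSolOne σ t * edgeSolTwo σ u + edgeSolTwo σ t * edgeSolOne σ u)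
    - ((3 + σ) * sinh L - (1 - σ) * L * cosh L) / 2 * (edgeSolTwo σ t * edgeSolTwo σ u)

lemma edgeSolTwo_pos {σ t : ℝ} (hσ0 : 0 ≤ σ) (hσ1 : σ < 1) (ht : 0 < t) :
    0 < edgeSolTwo σ t := by
  have h1 : 0 < sinh t := sinh_pos_iff.2 ht
  have h2 : 0 < cosh t := cosh_pos t
  have h3 : 0 < 1 - σ := sub_pos.2 hσ1
  unfold edgeSolTwo
  positivity

/-- The ratio of the first to the second fundamental solution is nonincreasing. -/
lemma edgeSol_ratio_antitone {σ t T : ℝ} (hσ0 : 0 ≤ σ) (hσ1 : σ < 1) (ht : 0 ≤ t)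
    (htT : t ≤ T) :
    edgeSolOne σ T * edgeSolTwo σ t ≤ edgeSolOne σ t * edgeSolTwo σ T := by
  have h1 : 0 ≤ sinh t := sinh_nonneg_iff.2 ht
  have h2 : 0 ≤ sinh T := sinh_nonneg_iff.2 (ht.trans htT)
  have h3 : 0 ≤ sinh (T - t) := sinh_nonneg_iff.2 (sub_nonneg.2 htT)
  have h4 : 0 < cosh t := cosh_pos t
  have h5 : 0 < cosh T := cosh_pos T
  have h6 : 0 < 1 - σ := sub_pos.2 hσ1
  have h7 : 0 ≤ T - t := sub_nonneg.2 htT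
  have h8 : 0 ≤ T := ht.trans htT
  have key : edgeSolOne σ t * edgeSolTwo σ T - edgeSolOne σ T * edgeSolTwo σ t
      = (1 + σ) * sinh (T - t) + (1 - σ) * (T - t) * (cosh t * cosh T)
        + (1 - σ) * (1 + σ) / 2 * (T - t) * (sinh t * sinh T)
        + (1 - σ) ^ 2 / 2 * t * T * sinh (T - t) := by
    rw [sinh_sub]; unfold edgeSolOne edgeSolTwo; ring
  rw [← sub_nonneg, key]
  positivity

/-- A combination of the fundamental solutions that is positive at `T` and has positive leading
coefficient is positive on `[0, T]`. -/
lemma edgeSol_combination_pos {σ p q t T : ℝ} (hσ0 : 0 ≤ σ) (hσ1 : σ < 1) (ht : 0 ≤ t)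
    (htT : t ≤ T) (hp : 0 < p) (hT : 0 < p * edgeSolOne σ T + q * edgeSolTwo σ T) :
    0 < p * edgeSolOne σ t + q * edgeSolTwo σ t := by
  rcases ht.eq_or_lt with rfl | ht'
  · simpa [edgeSolOne, edgeSolTwo] using hp
  · have h1 := edgeSolTwo_pos hσ0 hσ1 ht'
    have h2 := edgeSolTwo_pos hσ0 hσ1 (ht'.trans_le htT)
    have h3 := mul_le_mul_of_nonneg_left (edgeSol_ratio_antitone hσ0 hσ1 ht htT) hp.le
    refine (mul_pos_iff_of_pos_left h2).1 ?_
    linarith [mul_pos hT h1]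

lemma edgeWronskian_pos {σ : ℝ} (hσ0 : 0 ≤ σ) (hσ1 : σ < 1) (t : ℝ) :
    0 < edgeWronskian σ t := by
  have h : (1 + σ) ^ 2 / 2 * sinh t ^ 2 ≤ 2 * sinh t ^ 2 :=
    mul_le_mul_of_nonneg_right (by nlinarith) (sq_nonneg _)
  have h' : 0 ≤ (1 - σ) ^ 2 / 2 * t ^ 2 := by positivity
  unfold edgeWronskian
  linarith [cosh_sq t]

lemma edgeWronskianDeriv_pos {σ t : ℝ} (hσ0 : 0 ≤ σ) (hσ1 : σ < 1) (ht : 0 < t) :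
    0 < edgeWronskianDeriv σ t := by
  have h1 : 0 < sinh t := sinh_pos_iff.2 ht
  have h2 : 0 < cosh t := cosh_pos t
  have h3 : 0 < 1 - σ := sub_pos.2 hσ1
  unfold edgeWronskianDeriv
  positivity

lemma edgeWronskianDeriv_nonneg {σ t : ℝ} (hσ0 : 0 ≤ σ) (hσ1 : σ < 1) (ht : 0 ≤ t) :
    0 ≤ edgeWronskianDeriv σ t := by
  rcases ht.eq_or_lt with rfl | ht'
  · simp [edgeWronskianDeriv]
  · exact (edgeWronskianDeriv_pos hσ0 hσ1 ht').le

/-- On the diagonal the Green function is the derivative of a product of Wronskians. -/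
lemma greenNum_diagonal (σ t u : ℝ) :
    (1 - σ) * greenNum σ (t + u) t u
      = edgeWronskian σ t * edgeWronskianDeriv σ u
        + edgeWronskianDeriv σ t * edgeWronskian σ u := by
  unfold greenNum edgeSolOne edgeSolTwo edgeWronskian edgeWronskianDeriv
  rw [sinh_add, cosh_add]
  simp only [sinh_eq, cosh_eq, exp_neg]
  have h1 := (exp_pos t).ne'
  have h2 := (exp_pos u).ne'
  field_simp
  ring

lemma greenNum_diagonal_pos {σ t u : ℝ} (hσ0 : 0 ≤ σ) (hσ1 : σ < 1) (ht : 0 ≤ t) (hu : 0 ≤ u)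
    (htu : 0 < t + u) : 0 < greenNum σ (t + u) t u := by
  refine (mul_pos_iff_of_pos_left (sub_pos.2 hσ1)).1 ?_
  rw [greenNum_diagonal]
  have hWt := edgeWronskian_pos hσ0 hσ1 t
  have hWu := edgeWronskian_pos hσ0 hσ1 u
  rcases ht.eq_or_lt with rfl | ht'
  · have hu' : 0 < u := by simpa using htu
    exact add_pos_of_pos_of_nonneg (mul_pos hWt (edgeWronskianDeriv_pos hσ0 hσ1 hu'))
      (mul_nonneg (edgeWronskianDeriv_nonneg hσ0 hσ1 ht) hWu.le)
  · exact add_pos_of_nonneg_of_pos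
      (mul_nonneg hWt.le (edgeWronskianDeriv_nonneg hσ0 hσ1 hu))
      (mul_pos (edgeWronskianDeriv_pos hσ0 hσ1 ht') hWu)

lemma greenNum_zero_left (σ L u : ℝ) :
    greenNum σ L 0 u
      = 2 * ((3 + σ) * sinh L + (1 - σ) * L * cosh L) * edgeSolOne σ u
        + (1 - σ) * L * sinh L * edgeSolTwo σ u := by
  simp [greenNum, edgeSolOne, edgeSolTwo]

lemma greenNum_zero_left_pos {σ L u : ℝ} (hσ0 : 0 ≤ σ) (hσ1 : σ < 1) (hL : 0 < L) (hu : 0 ≤ u)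
    (huL : u ≤ L) : 0 < greenNum σ L 0 u := by
  have h1 : 0 < sinh L := sinh_pos_iff.2 hL
  have h2 : 0 < cosh L := cosh_pos L
  have h3 : 0 < 1 - σ := sub_pos.2 hσ1
  rw [greenNum_zero_left]
  refine edgeSol_combination_pos hσ0 hσ1 hu huL (by positivity) ?_
  rw [← greenNum_zero_left]
  simpa using greenNum_diagonal_pos (t := 0) (u := L) hσ0 hσ1 le_rfl hL.le (by simpa using hL)

lemma greenNum_pos {σ L t u : ℝ} (hσ0 : 0 ≤ σ) (hσ1 : σ < 1) (hL : 0 < L) (ht : 0 ≤ t)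
    (hu : 0 ≤ u) (htu : t + u ≤ L) : 0 < greenNum σ L t u := by
  have hsplit : ∀ x, greenNum σ L x u = greenNum σ L 0 u * edgeSolOne σ x
      + ((1 - σ) * L * sinh L * edgeSolOne σ u
        - ((3 + σ) * sinh L - (1 - σ) * L * cosh L) / 2 * edgeSolTwo σ u) * edgeSolTwo σ x := by
    intro x
    rw [greenNum_zero_left]
    unfold greenNum
    ring
  rw [hsplit]
  refine edgeSol_combination_pos (T := L - u) hσ0 hσ1 ht (by linarith)
    (greenNum_zero_left_pos hσ0 hσ1 hL hu (by linarith)) ?_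
  rw [← hsplit]
  simpa using greenNum_diagonal_pos (t := L - u) (u := u) hσ0 hσ1 (by linarith) hu
    (by simpa using hL)

lemma F_pos {σ z : ℝ} (hσ0 : 0 ≤ σ) (hz : 0 < z) : 0 < F σ z := by
  have h : 2 * z < sinh (2 * z) := self_lt_sinh_iff.2 (by linarith)
  unfold F
  nlinarith

lemma Fbar_pos {σ z : ℝ} (hσ0 : 0 ≤ σ) (hσ1 : σ < 1) (hz : 0 < z) : 0 < Fbar σ z := by
  have h : 0 < sinh (2 * z) := sinh_pos_iff.2 (by linarith)
  have h3 : 0 < 1 - σ := sub_pos.2 hσ1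
  unfold Fbar
  positivity

lemma g_comm (σ s k z : ℝ) : g σ s k z = g σ k s z := by
  unfold g zeta eta psi xi
  ring

lemma phi_comm (σ s k z : ℝ) : phi σ s k z = phi σ k s z := by
  simp only [phi, hfun, g_comm σ s k z, abs_sub_comm k s]

lemma phi_eq_greenNum {σ s k z : ℝ} (hσ0 : 0 ≤ σ) (hσ1 : σ < 1) (hz : 0 < z) (hsk : s ≤ k) :
    (1 - σ) * F σ z * Fbar σ z * phi σ s k z
      = greenNum σ (2 * z) (z + s * z) (z - k * z) := by
  have hF := (F_pos hσ0 hz).ne'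
  have hFb := (Fbar_pos hσ0 hσ1 hz).ne'
  have hb : 1 - σ ≠ 0 := (sub_pos.2 hσ1).ne'
  have hclear : (1 - σ) * F σ z * Fbar σ z * phi σ s k z
      = exp (-z) * (Fbar σ z * (cosh (s * z) * ((1 - σ) * zeta σ k z + (1 - σ) * z * psi σ k z)
            - (1 - σ) * s * z * sinh (s * z) * psi σ k z)
          + F σ z * (sinh (s * z) * ((1 - σ) * eta σ k z + (1 - σ) * z * xi σ k z)
            - (1 - σ) * s * z * cosh (s * z) * xi σ k z))
        + (1 - σ) * F σ z * Fbar σ z * hfun s k z := by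
    unfold phi g
    field_simp
    ring
  have hh : hfun s k z = (1 + (k * z - s * z)) * exp (s * z - k * z) := by
    rw [hfun, abs_of_nonneg (sub_nonneg.2 hsk)]
    ring_nf
  have hzeta : (1 - σ) * zeta σ k z
      = (4 - (1 - σ) * (1 + σ) * z) * cosh (k * z) * cosh z
        + ((1 + σ) ^ 2 + 2 * (1 - σ) * z) * cosh (k * z) * sinh z
        + (1 - σ) * (-2 * k * z * sinh (k * z) * cosh z
          + (1 + σ) * k * z * sinh (k * z) * sinh z) := by
    unfold zeta
    field_simp
    ring
  have heta : (1 - σ) * eta σ k z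
      = (1 - σ) * ((1 + σ) * k * z * cosh (k * z) * cosh z
          - 2 * k * z * cosh (k * z) * sinh z)
        + ((1 + σ) ^ 2 + 2 * (1 - σ) * z) * sinh (k * z) * cosh z
        + (4 - (1 - σ) * (1 + σ) * z) * sinh (k * z) * sinh z := by
    unfold eta
    field_simp
  rw [hclear, hh, hzeta, heta]
  unfold F Fbar psi xi greenNum edgeSolOne edgeSolTwo
  rw [sinh_two_mul, cosh_two_mul, sinh_add, cosh_add, sinh_sub, cosh_sub, exp_sub, exp_neg]
  simp only [sinh_eq, cosh_eq, exp_neg]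
  have h1 := (exp_pos z).ne'
  have h2 := (exp_pos (k * z)).ne'
  have h3 := (exp_pos (s * z)).ne'
  generalize exp z = X at *
  generalize exp (k * z) = Y at *
  generalize exp (s * z) = S at *
  field_simp
  ring

lemma phi_pos_of_le {σ s k z : ℝ} (hσ0 : 0 ≤ σ) (hσ1 : σ < 1) (hz : 0 < z) (hs : -1 ≤ s)
    (hk : k ≤ 1) (hsk : s ≤ k) : 0 < phi σ s k z := by
  have hpos : 0 < (1 - σ) * F σ z * Fbar σ z :=
    mul_pos (mul_pos (sub_pos.2 hσ1) (F_pos hσ0 hz)) (Fbar_pos hσ0 hσ1 hz)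
  refine (mul_pos_iff_of_pos_left hpos).1 ?_
  rw [phi_eq_greenNum hσ0 hσ1 hz hsk]
  exact greenNum_pos hσ0 hσ1 (by linarith) (by nlinarith) (by nlinarith) (by nlinarith)

/-- Positivity part of Theorem 2.1: for fixed σ ∈ [0,1), φ(s,k,z) > 0 for all z > 0
and all k, s ∈ [−1,1]. -/
theorem phi_pos (σ : ℝ) (hσ0 : 0 ≤ σ) (hσ1 : σ < 1) :
    ∀ z : ℝ, 0 < z → ∀ k ∈ Set.Icc (-1 : ℝ) 1, ∀ s ∈ Set.Icc (-1 : ℝ) 1,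
      0 < phi σ s k z := by
  intro z hz k hk s hs
  rcases le_total s k with h | h
  · exact phi_pos_of_le hσ0 hσ1 hz hs.1 hk.2 h
  · rw [phi_comm]
    exact phi_pos_of_le hσ0 hσ1 hz hk.1 hs.2 h
end
end

section
/- Fix a real number σ with 0 ≤ σ < 1 and let k ∈ [−1,1]. Then for every z > 0 the derivative with respect to z of the function z ↦ z·ψ(k,z)/F(z) + z·ξ(k,z)/F̄(z) is strictly less than ζ(k,z)/F(z) + η(k,z)/F̄(z), and the derivative with respect to z of the function z ↦ z·ψ(k,z)/F(z) − z·ξ(k,z)/F̄(z) is strictly less than ζ(k,z)/F(z) − η(k,z)/F̄(z). -/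
noncomputable section

open Real

/-- The sum `ψ + ξ`, written in exponentials. -/
def psiAddXi (σ k z : ℝ) : ℝ :=
  (1 - σ) * (1 - k) * z * exp ((1 + k) * z) + 2 * exp (-((1 + k) * z))
    + (1 - σ) * (exp ((1 + k) * z) - exp (-((1 + k) * z))) / 2

/-- The `z`-derivative of `z * (ψ + ξ)`. -/
def psiAddXiMulDeriv (σ k z : ℝ) : ℝ :=
  psiAddXi σ k z + z * ((1 - σ) * (1 - k) * (1 + (1 + k) * z) * exp ((1 + k) * z)
    - 2 * (1 + k) * exp (-((1 + k) * z))
    + (1 - σ) * (1 + k) * (exp ((1 + k) * z) + exp (-((1 + k) * z))) / 2)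

/-- The sum `ζ + η`, written in exponentials. -/
def zetaAddEta (σ k z : ℝ) : ℝ :=
  4 / (1 - σ) * exp ((1 + k) * z)
    - (3 + σ) * (exp ((1 + k) * z) - exp (-((1 + k) * z))) / 2
    + (1 - k) * z * ((1 - σ) * (exp ((1 + k) * z) + exp (-((1 + k) * z))) / 2
      - 2 * exp (-((1 + k) * z)))

lemma psi_add_xi (σ k z : ℝ) : psi σ k z + xi σ k z = psiAddXi σ k z := by
  have h₁ : exp ((1 + k) * z) = exp z * exp (k * z) := by rw [← exp_add]; ring_nf
  have h₂ : exp (-((1 + k) * z)) = exp (-z) * exp (-(k * z)) := by rw [← exp_add]; ring_nf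
  simp only [psi, xi, psiAddXi, cosh_eq, sinh_eq, h₁, h₂]
  ring

lemma zeta_add_eta {σ : ℝ} (hσ : σ < 1) (k z : ℝ) :
    zeta σ k z + eta σ k z = zetaAddEta σ k z := by
  have h₁ : exp ((1 + k) * z) = exp z * exp (k * z) := by rw [← exp_add]; ring_nf
  have h₂ : exp (-((1 + k) * z)) = exp (-z) * exp (-(k * z)) := by rw [← exp_add]; ring_nf
  have hc : 1 - σ ≠ 0 := by linarith
  simp only [zeta, eta, zetaAddEta, cosh_eq, sinh_eq, h₁, h₂]
  field_simp
  ring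

lemma psi_neg (σ k z : ℝ) : psi σ (-k) z = psi σ k z := by
  simp only [psi, neg_mul, cosh_neg, sinh_neg]; ring

lemma xi_neg (σ k z : ℝ) : xi σ (-k) z = -xi σ k z := by
  simp only [xi, neg_mul, cosh_neg, sinh_neg]; ring

lemma zeta_neg (σ k z : ℝ) : zeta σ (-k) z = zeta σ k z := by
  simp only [zeta, neg_mul, cosh_neg, sinh_neg]; ring

lemma eta_neg (σ k z : ℝ) : eta σ (-k) z = -eta σ k z := by
  simp only [eta, neg_mul, cosh_neg, sinh_neg]; ring

lemma hasDerivAt_mul_psiAddXi (σ k z : ℝ) :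
    HasDerivAt (fun t => t * psiAddXi σ k t) (psiAddXiMulDeriv σ k z) z := by
  have hm : HasDerivAt (fun t : ℝ => (1 + k) * t) (1 + k) z := by
    simpa using (hasDerivAt_id z).const_mul (1 + k)
  have hE := hm.exp
  have hE' := hm.neg.exp
  have h := (hasDerivAt_id z).mul
    (((((hasDerivAt_id z).const_mul ((1 - σ) * (1 - k))).mul hE).add (hE'.const_mul 2)).add
      (((hE.sub hE').const_mul (1 - σ)).div_const 2))
  refine h.congr_deriv ?_
  simp only [psiAddXiMulDeriv, psiAddXi, Pi.add_apply, Pi.mul_apply, Pi.sub_apply, Pi.neg_apply, id]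
  ring

lemma psiAddXi_pos {σ k z : ℝ} (hσ : σ < 1) (hk : k ∈ Set.Icc (-1 : ℝ) 1) (hz : 0 < z) :
    0 < psiAddXi σ k z := by
  have hc : 0 < 1 - σ := by linarith
  have hk₀ : 0 ≤ 1 - k := by linarith [hk.2]
  have hm : 0 ≤ (1 + k) * z := mul_nonneg (by linarith [hk.1]) hz.le
  have hE : 0 ≤ exp ((1 + k) * z) - exp (-((1 + k) * z)) :=
    sub_nonneg.2 (exp_le_exp.2 (by linarith))
  unfold psiAddXi
  positivity

/-- The vertex inequality in the limit where the two terms `z * (log F)_z` and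
`z * (log F̄)_z` are replaced by `2z`. -/
lemma psiAddXiMulDeriv_lt {σ k z : ℝ} (hσ0 : 0 ≤ σ) (hσ : σ < 1) (hk : k ∈ Set.Icc (-1 : ℝ) 1)
    (hz : 0 < z) :
    psiAddXiMulDeriv σ k z < zetaAddEta σ k z + 2 * z * psiAddXi σ k z := by
  have hc : 0 < 1 - σ := by linarith
  have hm : 0 ≤ (1 + k) * z := mul_nonneg (by linarith [hk.1]) hz.le
  have h4 : 4 ≤ 4 / (1 - σ) := by rw [le_div_iff₀ hc]; linarith
  have hcoeff : 0 < 4 / (1 - σ) - 2 + (1 - σ) * (((1 - k) * z) ^ 2 - (1 - k) * z) := by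
    nlinarith [mul_nonneg hc.le (sq_nonneg ((1 - k) * z - 1 / 2))]
  have h₁ := mul_pos hcoeff (exp_pos ((1 + k) * z))
  have h₂ : 0 ≤ (3 + σ) * ((1 + k) * z) * exp (-((1 + k) * z)) := by positivity
  unfold psiAddXiMulDeriv zetaAddEta psiAddXi
  linarith

lemma F_lt_Fbar {σ z : ℝ} (hσ : σ < 1) (hz : 0 < z) : F σ z < Fbar σ z := by
  have : 0 < (1 - σ) * z := mul_pos (by linarith) hz
  unfold F Fbar
  linarith

lemma hasDerivAt_F (σ z : ℝ) : HasDerivAt (F σ) ((3 + σ) * cosh (2 * z) - (1 - σ)) z := by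
  have h2 : HasDerivAt (fun t : ℝ => 2 * t) 2 z := by
    simpa using (hasDerivAt_id z).const_mul 2
  refine ((h2.sinh.const_mul ((3 + σ) / 2)).sub
    ((hasDerivAt_id z).const_mul (1 - σ))).congr_deriv ?_
  ring

lemma hasDerivAt_Fbar (σ z : ℝ) : HasDerivAt (Fbar σ) ((3 + σ) * cosh (2 * z) + (1 - σ)) z := by
  have h2 : HasDerivAt (fun t : ℝ => 2 * t) 2 z := by
    simpa using (hasDerivAt_id z).const_mul 2
  refine ((h2.sinh.const_mul ((3 + σ) / 2)).add
    ((hasDerivAt_id z).const_mul (1 - σ))).congr_deriv ?_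
  ring

lemma sinh_le_mul_cosh_s9 {w : ℝ} (hw : 0 ≤ w) : sinh w ≤ w * cosh w := by
  have hmono : MonotoneOn (fun t : ℝ => t * cosh t - sinh t) (Set.Ici 0) := by
    have hd (t : ℝ) : HasDerivAt (fun t : ℝ => t * cosh t - sinh t) (t * sinh t) t := by
      refine (((hasDerivAt_id t).mul (hasDerivAt_cosh t)).sub (hasDerivAt_sinh t)).congr_deriv ?_
      simp
    refine monotoneOn_of_deriv_nonneg (convex_Ici 0)
      (fun t _ => (hd t).continuousAt.continuousWithinAt)
      (fun t _ => (hd t).differentiableAt.differentiableWithinAt) fun t ht => ?_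
    rw [interior_Ici, Set.mem_Ioi] at ht
    rw [(hd t).deriv]
    exact mul_nonneg ht.le (sinh_nonneg_iff.2 ht.le)
  have := hmono Set.self_mem_Ici (Set.mem_Ici.2 hw) hw
  simp only [cosh_zero, sinh_zero, zero_mul, sub_zero] at this
  linarith

/-- The logarithmic derivative of `F` is at least that of `F̄`. -/
lemma Fbar_deriv_mul_F_le {σ z : ℝ} (hσ0 : 0 ≤ σ) (hσ : σ < 1) (hz : 0 < z) :
    ((3 + σ) * cosh (2 * z) + (1 - σ)) * F σ z ≤ ((3 + σ) * cosh (2 * z) - (1 - σ)) * Fbar σ z := by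
  have h := sinh_le_mul_cosh_s9 (by linarith : 0 ≤ 2 * z)
  have h' := mul_le_mul_of_nonneg_left h
    (mul_nonneg (by linarith : 0 ≤ 3 + σ) (by linarith : 0 ≤ 1 - σ))
  unfold F Fbar
  linarith

/-- The logarithmic derivatives of `F` and `F̄` have mean at least `2`. -/
lemma four_mul_F_mul_Fbar_le {σ z : ℝ} (hσ0 : 0 ≤ σ) (hσ : σ < 1) (hz : 0 < z) :
    4 * (F σ z * Fbar σ z) ≤ ((3 + σ) * cosh (2 * z) - (1 - σ)) * Fbar σ z
      + ((3 + σ) * cosh (2 * z) + (1 - σ)) * F σ z := by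
  have hprod : sinh (2 * z) * (cosh (2 * z) - sinh (2 * z)) = (1 - exp (-(4 * z))) / 2 := by
    have h₁ : exp (2 * z) * exp (-(2 * z)) = 1 := by rw [← exp_add]; simp
    have h₂ : exp (-(4 * z)) = exp (-(2 * z)) * exp (-(2 * z)) := by rw [← exp_add]; ring_nf
    rw [cosh_sub_sinh, sinh_eq, h₂]
    linarith
  have hexp : exp (-(4 * z)) * (1 + 4 * z) ≤ 1 := by
    have h₁ : exp (-(4 * z)) * exp (4 * z) = 1 := by rw [← exp_add]; simp
    have := mul_le_mul_of_nonneg_left (add_one_le_exp (4 * z)) (exp_pos (-(4 * z))).le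
    linarith
  have hz2 : 2 * z - 4 * z ^ 2 ≤ 1 - exp (-(4 * z)) := by
    by_contra! hlt
    nlinarith [mul_lt_mul_of_pos_right hlt (by linarith : 0 < 1 + 4 * z), mul_pos hz hz,
      mul_pos hz (mul_pos hz hz)]
  have hpos : 0 ≤ 1 - exp (-(4 * z)) := sub_nonneg.2 (exp_le_one_iff.2 (by linarith))
  have h₁ : (1 - σ) ^ 2 * (2 * z - 4 * z ^ 2) ≤ (1 - σ) ^ 2 * (1 - exp (-(4 * z))) :=
    mul_le_mul_of_nonneg_left hz2 (sq_nonneg _)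
  have h₂ : (1 - σ) ^ 2 * (1 - exp (-(4 * z))) ≤ (3 + σ) ^ 2 / 2 * (1 - exp (-(4 * z))) :=
    mul_le_mul_of_nonneg_right (by nlinarith) hpos
  have h₃ := congrArg (fun x => (3 + σ) ^ 2 * x) hprod
  unfold F Fbar
  linarith

/-- The vertex inequality with the sign `+`; the other sign follows by reflecting `k`. -/
lemma deriv_vertex_lt {σ k z : ℝ} (hσ0 : 0 ≤ σ) (hσ : σ < 1) (hk : k ∈ Set.Icc (-1 : ℝ) 1)
    (hz : 0 < z) :
    deriv (fun t : ℝ => t * psi σ k t / F σ t + t * xi σ k t / Fbar σ t) z <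
      zeta σ k z / F σ z + eta σ k z / Fbar σ z := by
  have hk' : -k ∈ Set.Icc (-1 : ℝ) 1 := ⟨by linarith [hk.2], by linarith [hk.1]⟩
  have hF := F_pos hσ0 hz
  have hlt := F_lt_Fbar hσ hz
  have hFbar := hF.trans hlt
  have hψ (t : ℝ) : psi σ k t = (psiAddXi σ k t + psiAddXi σ (-k) t) / 2 := by
    rw [← psi_add_xi, ← psi_add_xi, psi_neg, xi_neg]; ring
  have hξ (t : ℝ) : xi σ k t = (psiAddXi σ k t - psiAddXi σ (-k) t) / 2 := by
    rw [← psi_add_xi, ← psi_add_xi, psi_neg, xi_neg]; ring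
  have hζ : zeta σ k z = (zetaAddEta σ k z + zetaAddEta σ (-k) z) / 2 := by
    rw [← zeta_add_eta hσ, ← zeta_add_eta hσ, zeta_neg, eta_neg]; ring
  have hη : eta σ k z = (zetaAddEta σ k z - zetaAddEta σ (-k) z) / 2 := by
    rw [← zeta_add_eta hσ, ← zeta_add_eta hσ, zeta_neg, eta_neg]; ring
  have hcomb : (fun t : ℝ => t * psi σ k t / F σ t + t * xi σ k t / Fbar σ t) = fun t =>
      (t * psiAddXi σ k t + t * psiAddXi σ (-k) t) / 2 / F σ t
        + (t * psiAddXi σ k t - t * psiAddXi σ (-k) t) / 2 / Fbar σ t := by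
    funext t
    rw [hψ, hξ]
    ring
  have hU := hasDerivAt_mul_psiAddXi σ k z
  have hV := hasDerivAt_mul_psiAddXi σ (-k) z
  have hderiv := (((hU.add hV).div_const 2).div (hasDerivAt_F σ z) hF.ne').add
    (((hU.sub hV).div_const 2).div (hasDerivAt_Fbar σ z) hFbar.ne')
  have hlog := Fbar_deriv_mul_F_le hσ0 hσ hz
  have hmean := four_mul_F_mul_Fbar_le hσ0 hσ hz
  have hG := psiAddXiMulDeriv_lt hσ0 hσ hk hz
  have hG' := psiAddXiMulDeriv_lt hσ0 hσ hk' hz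
  have hP := mul_pos hz (psiAddXi_pos hσ hk hz)
  have hP' := mul_pos hz (psiAddXi_pos hσ hk' hz)
  have hderiv_eq := hderiv.deriv
  simp only [Pi.add_def, Pi.sub_def, Pi.div_def] at hderiv_eq
  rw [hcomb, hderiv_eq, hζ, hη]
  generalize (3 + σ) * cosh (2 * z) - (1 - σ) = f at *
  generalize (3 + σ) * cosh (2 * z) + (1 - σ) = f' at *
  generalize F σ z = X at *
  generalize Fbar σ z = Y at *
  generalize psiAddXi σ k z = u at *
  generalize psiAddXi σ (-k) z = v at *
  generalize psiAddXiMulDeriv σ k z = du at *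
  generalize psiAddXiMulDeriv σ (-k) z = dv at *
  generalize zetaAddEta σ k z = a at *
  generalize zetaAddEta σ (-k) z = b at *
  have hlog' : f' / Y ≤ f / X := by rw [div_le_div_iff₀ hFbar hF]; exact hlog
  have hmean' : 4 ≤ f / X + f' / Y := by
    rw [div_add_div _ _ hF.ne' hFbar.ne', le_div_iff₀ (mul_pos hF hFbar)]; linarith
  have hinv : 0 < 1 / X - 1 / Y := sub_pos.2 (one_div_lt_one_div_of_lt hF hlt)
  have hinv' : 0 < 1 / X + 1 / Y := by positivity
  have key : a * (1 / X + 1 / Y) + b * (1 / X - 1 / Y)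
      - (du * (1 / X + 1 / Y) + dv * (1 / X - 1 / Y))
      + z * u * (f / X * (1 / X) + f' / Y * (1 / Y))
      + z * v * (f / X * (1 / X) - f' / Y * (1 / Y)) > 0 := by
    have e₁ : 2 * (1 / X + 1 / Y) ≤ f / X * (1 / X) + f' / Y * (1 / Y) := by
      nlinarith [mul_nonneg (sub_nonneg.2 hlog') hinv.le,
        mul_nonneg (sub_nonneg.2 hmean') hinv'.le]
    have e₂ : 2 * (1 / X - 1 / Y) ≤ f / X * (1 / X) - f' / Y * (1 / Y) := by
      nlinarith [mul_nonneg (sub_nonneg.2 hlog') hinv'.le,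
        mul_nonneg (sub_nonneg.2 hmean') hinv.le]
    linarith [mul_le_mul_of_nonneg_left e₁ hP.le, mul_le_mul_of_nonneg_left e₂ hP'.le,
      mul_pos (sub_pos.2 hG) hinv', mul_pos (sub_pos.2 hG') hinv]
  rw [← sub_pos]
  refine (half_pos key).trans_eq ?_
  field_simp
  ring

/-- Inequality (4.5): for σ ∈ [0,1), k ∈ [−1,1] and z > 0,
[z·ψ/F ± z·ξ/F̄]_z < ζ/F ± η/F̄. -/
theorem vertex_ineq (σ : ℝ) (hσ0 : 0 ≤ σ) (hσ1 : σ < 1)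
    (k : ℝ) (hk : k ∈ Set.Icc (-1 : ℝ) 1) :
    ∀ z : ℝ, 0 < z →
      deriv (fun t : ℝ => t * psi σ k t / F σ t + t * xi σ k t / Fbar σ t) z <
        zeta σ k z / F σ z + eta σ k z / Fbar σ z ∧
      deriv (fun t : ℝ => t * psi σ k t / F σ t - t * xi σ k t / Fbar σ t) z <
        zeta σ k z / F σ z - eta σ k z / Fbar σ z := by
  intro z hz
  refine ⟨deriv_vertex_lt hσ0 hσ1 hk hz, ?_⟩
  have h := deriv_vertex_lt hσ0 hσ1 (k := -k) ⟨by linarith [hk.2], by linarith [hk.1]⟩ hz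
  simpa only [psi_neg, xi_neg, zeta_neg, eta_neg, mul_neg, neg_div, ← sub_eq_add_neg] using h
end
end
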